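/- arXiv:2004.10513 — 9 statements merged into one kernel-verified Lean document; each statement's English description precedes it below -/
import Mathlib

section
/- Let M be a monoid. Then M is a group if and only if for every right M-set X and every sub-M-set S of X, the complement X \ S is also a sub-M-set of X (i.e., every sub-M-set is complemented). -/
/-- `S` is a sub-`M`-set of the right `M`-set `X`. -/
def IsSubMSet (M : Type*) [Monoid M] {X : Type*} [MulAction Mᵐᵒᵖ X] (S : Set X) : Prop :=
  ∀ x ∈ S, ∀ m : M, MulOpposite.op m • x ∈ S

theorem IsSubMSet.compl {M : Type*} [Monoid M] (hM : ∀ m : M, IsUnit m) {X : Type*}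
    [MulAction Mᵐᵒᵖ X] {S : Set X} (hS : IsSubMSet M S) : IsSubMSet M Sᶜ := by
  intro x hx m hxm
  obtain ⟨u, rfl⟩ := hM m
  apply hx
  have h := hS _ hxm (↑u⁻¹ : M)
  rwa [smul_smul, ← MulOpposite.op_mul, Units.mul_inv, MulOpposite.op_one, one_smul] at h

theorem isSubMSet_setOf_dvd {M : Type*} [Monoid M] (a : M) : IsSubMSet M {x : M | a ∣ x} :=
  fun _ hx m => Dvd.dvd.mul_right hx m

theorem isUnit_of_forall_exists_mul_eq_one {M : Type*} [Monoid M]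
    (h : ∀ a : M, ∃ b, a * b = 1) (a : M) : IsUnit a := by
  obtain ⟨b, hab⟩ := h a
  obtain ⟨c, hbc⟩ := h b
  have hac : a = c := left_inv_eq_right_inv hab hbc
  exact ⟨⟨a, b, hab, hac ▸ hbc⟩, rfl⟩

theorem stmt1 (M : Type u) [Monoid M] :
    (∀ m : M, IsUnit m) ↔
      ∀ (X : Type u) [MulAction Mᵐᵒᵖ X] (S : Set X), IsSubMSet M S → IsSubMSet M Sᶜ := by
  refine ⟨fun hM X _ S hS => hS.compl hM, fun h => ?_⟩
  refine isUnit_of_forall_exists_mul_eq_one fun a => ?_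
  by_contra hne
  have h_one : (1 : M) ∈ {x : M | a ∣ x}ᶜ := fun ⟨b, hb⟩ => hne ⟨b, hb.symm⟩
  refine h M _ (isSubMSet_setOf_dvd a) 1 h_one a ?_
  simp
end

section
/- Let M be a monoid and S a nonempty subset of M. Define inductively S₀ = S and, for i ∈ ℕ, S_{i+1} = { m ∈ M | ∃ t ∈ ⟨S_i⟩, t * m ∈ ⟨S_i⟩ }, where ⟨T⟩ denotes the submonoid of M generated by T. Then the union ⋃_{i ∈ ℕ} S_i is exactly the right-factorable submonoid of M generated by S, i.e., the smallest right-factorable submonoid of M containing S. -/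
/-- A submonoid `T` of `M` is right-factorable if whenever `x ∈ T` and `x * y ∈ T`,
also `y ∈ T`. -/
def IsRightFactorable {M : Type*} [Monoid M] (T : Submonoid M) : Prop :=
  ∀ x y : M, x ∈ T → x * y ∈ T → y ∈ T

theorem stmt2 (M : Type*) [Monoid M] (S : Set M) (hS : S.Nonempty)
    (seq : ℕ → Set M) (h0 : seq 0 = S)
    (hsucc : ∀ i : ℕ, seq (i + 1) =
      {m : M | ∃ t ∈ Submonoid.closure (seq i), t * m ∈ Submonoid.closure (seq i)}) :
    ∃ T : Submonoid M, (T : Set M) = ⋃ i : ℕ, seq i ∧ IsRightFactorable T ∧ S ⊆ T ∧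
      ∀ T' : Submonoid M, IsRightFactorable T' → S ⊆ T' → T ≤ T' := by
  have hle (i : ℕ) : (Submonoid.closure (seq i) : Set M) ⊆ seq (i + 1) := by
    intro m hm
    rw [hsucc]
    exact ⟨1, one_mem _, by simpa using hm⟩
  have hmono : Monotone seq :=
    monotone_nat_of_le_succ fun i => Submonoid.subset_closure.trans (hle i)
  have hcommon {x y : M} (hx : x ∈ ⋃ i, seq i) (hy : y ∈ ⋃ i, seq i) :
      ∃ i, x ∈ Submonoid.closure (seq i) ∧ y ∈ Submonoid.closure (seq i) := by
    obtain ⟨i, hi⟩ := Set.mem_iUnion.1 hx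
    obtain ⟨j, hj⟩ := Set.mem_iUnion.1 hy
    exact ⟨max i j, Submonoid.subset_closure (hmono (le_max_left i j) hi),
      Submonoid.subset_closure (hmono (le_max_right i j) hj)⟩
  let T : Submonoid M :=
    { carrier := ⋃ i, seq i
      one_mem' := Set.mem_iUnion.2 ⟨1, hle 0 (one_mem _)⟩
      mul_mem' := fun hx hy => by
        obtain ⟨i, hi, hj⟩ := hcommon hx hy
        exact Set.mem_iUnion.2 ⟨i + 1, hle i (mul_mem hi hj)⟩ }
  refine ⟨T, rfl, ?_, ?_, ?_⟩
  · intro x y hx hxy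
    obtain ⟨i, hi, hj⟩ := hcommon hx hxy
    refine Set.mem_iUnion.2 ⟨i + 1, ?_⟩
    rw [hsucc]
    exact ⟨x, hi, hj⟩
  · intro x hx
    exact Set.mem_iUnion.2 ⟨0, h0 ▸ hx⟩
  · intro T' hT' hST'
    refine Set.iUnion_subset fun i => ?_
    induction i with
    | zero => exact h0 ▸ hST'
    | succ i ih =>
      have hcl := Submonoid.closure_le.2 ih
      rw [hsucc]
      rintro m ⟨t, ht, htm⟩
      exact hT' t m (hcl ht) (hcl htm)
end

section
/- Let M be a monoid and S a nonempty subset of M. Let ∼_S be the right congruence on M generated by the relations x ∼ 1 for x ∈ S, i.e., the smallest equivalence relation on M containing all pairs (x, 1) with x ∈ S and satisfying: a ∼_S b implies a * c ∼_S b * c for all c ∈ M. Then the right-factorable submonoid of M generated by S equals { m ∈ M | m ∼_S 1 }. -/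
/-- `r` is a right congruence on the monoid `M`: an equivalence relation compatible with
right multiplication. -/
def IsRightCongruence (M : Type*) [Monoid M] (r : M → M → Prop) : Prop :=
  Equivalence r ∧ ∀ a b c : M, r a b → r (a * c) (b * c)

theorem stmt3 (M : Type*) [Monoid M] (S : Set M) (hS : S.Nonempty)
    (r : M → M → Prop)
    -- `r` is the right congruence generated by the relations `x ∼ 1` for `x ∈ S`:
    (hr : IsRightCongruence M r) (hrS : ∀ x ∈ S, r x 1)
    (hmin : ∀ r' : M → M → Prop, IsRightCongruence M r' → (∀ x ∈ S, r' x 1) →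
      ∀ a b : M, r a b → r' a b) :
    -- the right-factorable submonoid generated by `S` equals `{ m | m ∼ 1 }`:
    ∃ T : Submonoid M, IsRightFactorable T ∧ S ⊆ T ∧
      (∀ T' : Submonoid M, IsRightFactorable T' → S ⊆ T' → T ≤ T') ∧
      (T : Set M) = {m : M | r m 1} := by
  obtain ⟨heq, hmul⟩ := hr
  have cancel : ∀ {x : M}, r x 1 → ∀ y, r (x * y) y := fun {x} hx y => by
    simpa using hmul x 1 y hx
  refine ⟨{ carrier := {m | r m 1}
            one_mem' := heq.refl 1
            mul_mem' := fun {a b} ha hb => heq.trans (cancel ha b) hb },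
    fun x y hx hxy => heq.trans (heq.symm (cancel hx y)) hxy, hrS, ?_, rfl⟩
  intro T' hT' hST' m hm
  have hsyn := hmin (fun a b => ∀ c, a * c ∈ T' ↔ b * c ∈ T')
    ⟨⟨fun _ _ => Iff.rfl, fun h c => (h c).symm, fun h h' c => (h c).trans (h' c)⟩,
      fun a b c h d => by simpa only [mul_assoc] using h (c * d)⟩
    (fun x hx c => by
      rw [one_mul]
      exact ⟨hT' x c (hST' hx), T'.mul_mem (hST' hx)⟩)
    m 1 hm 1
  rw [mul_one, mul_one] at hsyn
  exact hsyn.mpr T'.one_mem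
end

section
/- Let M be a monoid. Then M has a right absorbing element if and only if for every surjective M-map f : X → Y between right M-sets and every fixed point y of Y, there exists a fixed point x of X with f(x) = y. -/
/-- `f` is an `M`-map between right `M`-sets. -/
def IsMMap (M : Type*) [Monoid M] {X Y : Type*} [MulAction Mᵐᵒᵖ X] [MulAction Mᵐᵒᵖ Y]
    (f : X → Y) : Prop :=
  ∀ (x : X) (m : M), f (MulOpposite.op m • x) = MulOpposite.op m • f x

theorem stmt8 (M : Type u) [Monoid M] :
    (∃ r : M, ∀ m : M, r * m = r) ↔
      ∀ (X Y : Type u) [MulAction Mᵐᵒᵖ X] [MulAction Mᵐᵒᵖ Y] (f : X → Y),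
        IsMMap M f → Function.Surjective f →
          ∀ y : Y, (∀ m : M, MulOpposite.op m • y = y) →
            ∃ x : X, (∀ m : M, MulOpposite.op m • x = x) ∧ f x = y := by
  constructor
  · rintro ⟨r, hr⟩ X Y _ _ f hf hsurj y hy
    obtain ⟨x, rfl⟩ := hsurj y
    refine ⟨MulOpposite.op r • x, fun m => ?_, ?_⟩
    · rw [smul_smul, ← MulOpposite.op_mul, hr]
    · rw [hf, hy]
  · intro h
    obtain ⟨r, hr, -⟩ := h M PUnit (fun _ => PUnit.unit) (fun _ _ => rfl)
      (fun _ => ⟨1, rfl⟩) PUnit.unit (fun _ => rfl)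
    exact ⟨r, hr⟩
end

section
/- Let M be a monoid. Then M satisfies the right Ore condition if and only if for every indecomposable right M-set X, any two nonempty sub-M-sets A₁, A₂ of X have nonempty intersection. -/
/-- Two elements of a right `M`-set are connected: related by the equivalence relation
generated by the pairs `(x, x · m)`. -/
def MConn (M : Type*) [Monoid M] {X : Type*} [MulAction Mᵐᵒᵖ X] (a b : X) : Prop :=
  Relation.EqvGen (fun x y => ∃ m : M, y = MulOpposite.op m • x) a b

/-- A right `M`-set is indecomposable if nonempty and any two elements are connected. -/
def MIndec (M : Type*) [Monoid M] (X : Type*) [MulAction Mᵐᵒᵖ X] : Prop :=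
  Nonempty X ∧ ∀ a b : X, MConn M a b

/-- The right Ore condition for a monoid `M`. -/
def RightOre (M : Type*) [Monoid M] : Prop :=
  ∀ m₁ m₂ : M, ∃ n₁ n₂ : M, m₁ * n₁ = m₂ * n₂

open MulOpposite in
/-- Under the right Ore condition, connected elements have a common multiple. -/
theorem MConn.exists_smul_eq_smul {M : Type*} [Monoid M] (hM : RightOre M) {X : Type*}
    [MulAction Mᵐᵒᵖ X] {a b : X} (h : MConn M a b) :
    ∃ m n : M, op m • a = op n • b := by
  induction h with
  | rel x y h =>
    obtain ⟨m, rfl⟩ := h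
    exact ⟨m, 1, by simp⟩
  | refl x => exact ⟨1, 1, rfl⟩
  | symm x y _ ih =>
    obtain ⟨m, n, h⟩ := ih
    exact ⟨n, m, h.symm⟩
  | trans x y z _ _ ih₁ ih₂ =>
    obtain ⟨m, n, h⟩ := ih₁
    obtain ⟨p, q, h'⟩ := ih₂
    obtain ⟨r, s, hrs⟩ := hM n p
    exact ⟨m * r, q * s, by
      rw [op_mul, op_mul, mul_smul, mul_smul, h, ← h', ← mul_smul, ← mul_smul, ← op_mul,
        ← op_mul, hrs]⟩

/-- A monoid is indecomposable as a right set over itself. -/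
theorem mIndec_self (M : Type*) [Monoid M] : MIndec M M := by
  have h (a : M) : MConn M 1 a := .rel _ _ ⟨a, by simp⟩
  exact ⟨⟨1⟩, fun a b => ((h a).symm _ _).trans _ _ _ (h b)⟩

/-- The principal right ideal generated by an element is a sub-`M`-set. -/
theorem isSubMSet_range_mul_left {M : Type*} [Monoid M] (a : M) :
    IsSubMSet M (Set.range (a * ·)) := by
  rintro _ ⟨n, rfl⟩ m
  exact ⟨n * m, by simp [mul_assoc]⟩

theorem stmt9 (M : Type u) [Monoid M] :
    RightOre M ↔
      ∀ (X : Type u) [MulAction Mᵐᵒᵖ X], MIndec M X →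
        ∀ A₁ A₂ : Set X, IsSubMSet M A₁ → IsSubMSet M A₂ →
          A₁.Nonempty → A₂.Nonempty → (A₁ ∩ A₂).Nonempty := by
  constructor
  · rintro hM X _ ⟨_, hX⟩ A₁ A₂ h₁ h₂ ⟨a, ha⟩ ⟨b, hb⟩
    obtain ⟨m, n, h⟩ := (hX a b).exists_smul_eq_smul hM
    exact ⟨_, h₁ a ha m, h ▸ h₂ b hb n⟩
  · intro h m₁ m₂
    obtain ⟨_, ⟨n₁, rfl⟩, n₂, hn⟩ := h M (mIndec_self M) _ _ (isSubMSet_range_mul_left m₁)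
      (isSubMSet_range_mul_left m₂) (Set.range_nonempty _) (Set.range_nonempty _)
    exact ⟨n₁, n₂, hn.symm⟩
end

section
/- Let M be a monoid. Then M is right collapsible if and only if M satisfies the right Ore condition and M × M, regarded as a right M-set via the diagonal action (x, y) · m = (x * m, y * m), is indecomposable. -/
/-- `M` is right collapsible. -/
def RightCollapsible (M : Type*) [Monoid M] : Prop :=
  ∀ m₁ m₂ : M, ∃ m : M, m₁ * m = m₂ * m

/-- Under the right Ore condition, connected elements of a right `M`-set have a common
translate. -/
theorem MConn.exists_smul_eq {M X : Type*} [Monoid M] [MulAction Mᵐᵒᵖ X] (h : RightOre M)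
    {a b : X} (hab : MConn M a b) :
    ∃ m n : M, MulOpposite.op m • a = MulOpposite.op n • b := by
  induction hab with
  | rel x y hxy =>
    obtain ⟨m, rfl⟩ := hxy
    exact ⟨m, 1, by simp⟩
  | refl x => exact ⟨1, 1, rfl⟩
  | symm x y _ ih =>
    obtain ⟨m, n, hmn⟩ := ih
    exact ⟨n, m, hmn.symm⟩
  | trans x y z _ _ ih₁ ih₂ =>
    obtain ⟨m, n, hmn⟩ := ih₁
    obtain ⟨p, q, hpq⟩ := ih₂
    obtain ⟨r, s, hrs⟩ := h n p
    refine ⟨m * r, q * s, ?_⟩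
    rw [MulOpposite.op_mul, MulOpposite.op_mul, mul_smul, mul_smul, hmn, ← hpq, ← mul_smul,
      ← mul_smul, ← MulOpposite.op_mul, ← MulOpposite.op_mul, hrs]

/-- In a right collapsible monoid, every pair is connected to `(1, 1)`. -/
theorem RightCollapsible.mConn_one {M : Type*} [Monoid M] (h : RightCollapsible M)
    (a : M × M) : MConn M a 1 := by
  obtain ⟨m, hm⟩ := h a.1 a.2
  refine .trans _ (MulOpposite.op m • a) _ (.rel _ _ ⟨m, rfl⟩)
    (.symm _ _ (.rel _ _ ⟨a.1 * m, ?_⟩))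
  ext <;> simp [hm]

theorem stmt13 (M : Type*) [Monoid M] :
    RightCollapsible M ↔ RightOre M ∧ MIndec M (M × M) := by
  constructor
  · intro h
    refine ⟨fun a b => ?_, ⟨1⟩, fun a b => .trans _ _ _ (h.mConn_one a) (.symm _ _ (h.mConn_one b))⟩
    obtain ⟨m, hm⟩ := h a b
    exact ⟨m, m, hm⟩
  · rintro ⟨hO, -, hc⟩ a b
    obtain ⟨m, n, hmn⟩ := (hc (a, b) (1, 1)).exists_smul_eq hO
    simp only [Prod.smul_mk, op_smul_eq_mul, one_mul, Prod.mk.injEq] at hmn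
    exact ⟨m, hmn.1.trans hmn.2.symm⟩
end

section
/- Let M be a monoid. Then M is right collapsible if and only if for all indecomposable right M-sets X and Y and all M-maps f, g : X → Y, there exists x ∈ X with f(x) = g(x). -/
/-- Over a right collapsible monoid, connected elements become equal after acting by a common
element. -/
theorem RightCollapsible.exists_op_smul_eq {M : Type*} [Monoid M] (hM : RightCollapsible M)
    {X : Type*} [MulAction Mᵐᵒᵖ X] {a b : X} (h : MConn M a b) :
    ∃ m : M, MulOpposite.op m • a = MulOpposite.op m • b := by
  induction h with
  | rel x y hxy =>
    obtain ⟨k, rfl⟩ := hxy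
    obtain ⟨m, hm⟩ := hM 1 k
    exact ⟨m, by rw [smul_smul, ← MulOpposite.op_mul, ← hm, one_mul]⟩
  | refl x => exact ⟨1, rfl⟩
  | symm x y _ ih =>
    obtain ⟨m, hm⟩ := ih
    exact ⟨m, hm.symm⟩
  | trans x y z _ _ ih₁ ih₂ =>
    obtain ⟨m, hm⟩ := ih₁
    obtain ⟨n, hn⟩ := ih₂
    obtain ⟨p, hp⟩ := hM m n
    refine ⟨m * p, ?_⟩
    rw [MulOpposite.op_mul, mul_smul, hm, ← mul_smul, ← MulOpposite.op_mul, hp,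
      MulOpposite.op_mul, mul_smul, hn, mul_smul]

/-- Left multiplication is a map of right `M`-sets. -/
theorem isMMap_mul_left {M : Type*} [Monoid M] (a : M) : IsMMap M (a * · : M → M) :=
  fun x m => by simp [mul_assoc]

theorem stmt14 (M : Type u) [Monoid M] :
    RightCollapsible M ↔
      ∀ (X Y : Type u) [MulAction Mᵐᵒᵖ X] [MulAction Mᵐᵒᵖ Y],
        MIndec M X → MIndec M Y →
          ∀ f g : X → Y, IsMMap M f → IsMMap M g → ∃ x : X, f x = g x := by
  constructor
  · rintro hM X Y _ _ ⟨⟨x⟩, -⟩ ⟨-, hY⟩ f g hf hg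
    obtain ⟨m, hm⟩ := hM.exists_op_smul_eq (hY (f x) (g x))
    exact ⟨MulOpposite.op m • x, by rw [hf, hg, hm]⟩
  · intro h m₁ m₂
    exact h M M (mIndec_self M) (mIndec_self M) _ _ (isMMap_mul_left m₁) (isMMap_mul_left m₂)
end

section
/- Let M be a monoid that does not satisfy the right Ore condition. Then there exists an indecomposable right M-set X such that the countable power X^ℕ = (ℕ → X), equipped with the pointwise action (f · m)(n) = f(n) · m, is not indecomposable. -/
open Classical in
/-- The function on `M` with value `2 * n` on `p * M`, `2 * n + 2` on `q * M` and `2 * n + 1`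
elsewhere. -/
noncomputable def zigzagFun {M : Type*} [Monoid M] (p q : M) (n : ℕ) (k : M) : ℕ :=
  if p ∣ k then 2 * n else if q ∣ k then 2 * n + 2 else 2 * n + 1

/-- The right `M`-set of translates of the functions `zigzagFun p q n`. -/
def Zigzag {M : Type*} [Monoid M] (p q : M) : Type _ :=
  {g : M → ℕ // ∃ n m, g = fun k => zigzagFun p q n (m * k)}

namespace Zigzag

variable {M : Type*} [Monoid M] {p q : M}

instance : MulAction Mᵐᵒᵖ (Zigzag p q) where
  smul a g := ⟨fun k => g.1 (a.unop * k), by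
    obtain ⟨_, n, m, rfl⟩ := g
    exact ⟨n, m * a.unop, by simp only [mul_assoc]⟩⟩
  one_smul g := Subtype.ext <| funext fun k => congrArg g.1 (one_mul k)
  mul_smul a b g := Subtype.ext <| funext fun k => congrArg g.1 (mul_assoc b.unop a.unop k)

theorem smul_val (m : M) (g : Zigzag p q) (k : M) :
    (MulOpposite.op m • g).1 k = g.1 (m * k) := rfl

/-- The `n`-th generator of the zigzag. -/
noncomputable def gen (p q : M) (n : ℕ) : Zigzag p q :=
  ⟨zigzagFun p q n, n, 1, by simp only [one_mul]⟩

theorem gen_val (n : ℕ) (k : M) : (gen p q n).1 k = zigzagFun p q n k := rfl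

theorem exists_eq_smul_gen (g : Zigzag p q) :
    ∃ (n : ℕ) (m : M), g = MulOpposite.op m • gen p q n := by
  obtain ⟨_, n, m, rfl⟩ := g
  exact ⟨n, m, rfl⟩

theorem smul_gen_eq_smul_gen_succ (h : ∀ a b : M, p * a ≠ q * b) (n : ℕ) :
    MulOpposite.op q • gen p q n = MulOpposite.op p • gen p q (n + 1) := by
  refine Subtype.ext <| funext fun k => ?_
  have hk : ¬ p ∣ q * k := fun ⟨a, ha⟩ => h a k ha.symm
  simp only [smul_val, gen_val, zigzagFun, hk, dvd_mul_right, if_true, if_false]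
  ring

theorem mConn_gen_zero (h : ∀ a b : M, p * a ≠ q * b) (n : ℕ) :
    MConn M (gen p q 0) (gen p q n) := by
  induction n with
  | zero => exact .refl _
  | succ n ih =>
    refine ih.trans _ _ _ (.trans _ _ _ (.rel _ _ ⟨q, rfl⟩) (.symm _ _ (.rel _ _ ⟨p, ?_⟩)))
    exact smul_gen_eq_smul_gen_succ h n

theorem mIndec (h : ∀ a b : M, p * a ≠ q * b) : MIndec M (Zigzag p q) := by
  have key (g : Zigzag p q) : MConn M (gen p q 0) g := by
    obtain ⟨n, m, rfl⟩ := g.exists_eq_smul_gen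
    exact (mConn_gen_zero h n).trans _ _ _ (.rel _ _ ⟨m, rfl⟩)
  exact ⟨⟨gen p q 0⟩, fun a b => ((key a).symm _ _).trans _ _ _ (key b)⟩

theorem dist_smul_le_one (h : ∀ a b : M, p * a ≠ q * b) (g : Zigzag p q) (m : M) :
    dist (g.1 1) ((MulOpposite.op m • g).1 1) ≤ 1 := by
  obtain ⟨n, a, rfl⟩ := g.exists_eq_smul_gen
  simp only [smul_val, gen_val, mul_one, zigzagFun, Nat.dist_eq]
  by_cases hp : p ∣ a
  · simp [hp, hp.mul_right m]
  · by_cases hq : q ∣ a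
    · have hpm : ¬ p ∣ a * m := fun ⟨b, hb⟩ => by
        obtain ⟨c, hc⟩ := hq.mul_right m
        exact h b c (hb.symm.trans hc)
      simp [hp, hq, hpm, hq.mul_right m]
    · simp only [hp, hq, if_false]
      split_ifs <;> push_cast <;> rw [abs_le] <;> constructor <;> linarith

theorem exists_dist_le_of_mConn (h : ∀ a b : M, p * a ≠ q * b) {ι : Type*}
    {x y : ι → Zigzag p q} (hxy : MConn M x y) :
    ∃ C : ℝ, ∀ i, dist ((x i).1 1) ((y i).1 1) ≤ C := by
  induction hxy with
  | rel x y hm =>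
    obtain ⟨m, rfl⟩ := hm
    exact ⟨1, fun i => dist_smul_le_one h (x i) m⟩
  | refl x => exact ⟨0, fun i => (dist_self _).le⟩
  | symm x y _ ih =>
    obtain ⟨C, hC⟩ := ih
    exact ⟨C, fun i => dist_comm ((y i).1 1) _ ▸ hC i⟩
  | trans x y z _ _ ih₁ ih₂ =>
    obtain ⟨C, hC⟩ := ih₁
    obtain ⟨D, hD⟩ := ih₂
    exact ⟨C + D, fun i => (dist_triangle _ _ _).trans (add_le_add (hC i) (hD i))⟩

theorem not_mIndec_pi (h : ∀ a b : M, p * a ≠ q * b) : ¬ MIndec M (ℕ → Zigzag p q) := by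
  intro hX
  obtain ⟨C, hC⟩ := exists_dist_le_of_mConn h (hX.2 (gen p q) fun _ => gen p q 0)
  obtain ⟨n, hn⟩ := exists_nat_gt (C + 2)
  have hlow : 2 * n ≤ (gen p q n).1 1 := by
    rw [gen_val, zigzagFun]
    split_ifs <;> omega
  have hupp : (gen p q 0).1 1 ≤ 2 := by
    rw [gen_val, zigzagFun]
    split_ifs <;> omega
  have hd := (le_abs_self _).trans (Nat.dist_eq _ _ ▸ hC n)
  have hlow' : (2 * n : ℝ) ≤ (gen p q n).1 1 := mod_cast hlow
  have hupp' : ((gen p q 0).1 1 : ℝ) ≤ 2 := mod_cast hupp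
  linarith [(Nat.cast_nonneg n : (0 : ℝ) ≤ n)]

end Zigzag

theorem stmt18 (M : Type u) [Monoid M] (h : ¬ RightOre M) :
    ∃ (X : Type u) (inst : MulAction Mᵐᵒᵖ X),
      MIndec M X ∧ ¬ MIndec M (ℕ → X) := by
  simp only [RightOre, not_forall, not_exists] at h
  obtain ⟨p, q, hpq⟩ := h
  exact ⟨Zigzag p q, inferInstance, Zigzag.mIndec hpq, Zigzag.not_mIndec_pi hpq⟩
end

section
/- Let M be a monoid. Then M has a zero element if and only if for every right M-set X and every x ∈ X, there is exactly one fixed point of X connected to x (i.e., each connected component of each right M-set contains exactly one fixed point). -/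
/-- A right zero of `M` acts in the same way on connected elements. -/
theorem MConn.op_smul_eq {M X : Type*} [Monoid M] [MulAction Mᵐᵒᵖ X] {z : M}
    (hz : ∀ m : M, m * z = z) {a b : X} (h : MConn M a b) :
    MulOpposite.op z • a = MulOpposite.op z • b := by
  induction h with
  | rel x y h =>
    obtain ⟨m, rfl⟩ := h
    rw [smul_smul, ← MulOpposite.op_mul, hz]
  | refl x => rfl
  | symm x y _ ih => exact ih.symm
  | trans x y w _ _ ih₁ ih₂ => exact ih₁.trans ih₂

theorem stmt19 (M : Type u) [Monoid M] :
    (∃ z : M, ∀ m : M, m * z = z ∧ z * m = z) ↔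
      ∀ (X : Type u) [MulAction Mᵐᵒᵖ X] (x : X),
        ∃! y : X, (∀ m : M, MulOpposite.op m • y = y) ∧ MConn M x y := by
  constructor
  · rintro ⟨z, hz⟩ X _ x
    refine ⟨MulOpposite.op z • x, ⟨fun m => ?_, .rel _ _ ⟨z, rfl⟩⟩, ?_⟩
    · rw [smul_smul, ← MulOpposite.op_mul, (hz m).2]
    · rintro y ⟨hy, hxy⟩
      rw [hxy.op_smul_eq fun m => (hz m).1, hy]
  · intro h
    obtain ⟨z, ⟨hz, -⟩, huniq⟩ := h M 1
    simp only [op_smul_eq_mul] at hz huniq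
    refine ⟨z, fun m => ⟨huniq _ ⟨fun n => ?_, .rel _ _ ⟨m * z, ?_⟩⟩, hz m⟩⟩
    · rw [mul_assoc, hz]
    · rw [op_smul_eq_mul, one_mul]
end
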